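/- arXiv:2106.13925 — 6 statements merged into one kernel-verified Lean document; each statement's English description precedes it below -/
import Mathlib

section
/- Let f be a probability density on ℝ and define π₀ := sup{π ∈ [0,1] : there exists a probability density g with g(x) = g(−x) for almost every x and f − π g ≥ 0 almost everywhere}. Then π₀ = ∫_ℝ min{f(x), f(−x)} dx. -/
open MeasureTheory

/-- For a probability density `f` on ℝ, the largest proportion `π₀` of an
even (symmetric about the origin) density `g` that fits under `f` equals
`∫ min (f x) (f (-x)) dx`. -/
theorem symmetric_background_proportion
    (f : ℝ → ℝ) (hf_meas : Measurable f)
    (hf_nonneg : ∀ᵐ x ∂(volume : Measure ℝ), 0 ≤ f x)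
    (hf_int : ∫ x, f x = 1) :
    sSup {π : ℝ | π ∈ Set.Icc (0 : ℝ) 1 ∧
        ∃ g : ℝ → ℝ, Measurable g ∧ (∀ᵐ x ∂(volume : Measure ℝ), 0 ≤ g x) ∧
          (∫ x, g x = 1) ∧ (∀ᵐ x ∂(volume : Measure ℝ), g x = g (-x)) ∧
          (∀ᵐ x ∂(volume : Measure ℝ), 0 ≤ f x - π * g x)} =
      ∫ x, min (f x) (f (-x)) := by
  have hfi : Integrable f := by
    by_contra h
    rw [integral_undef h] at hf_int
    exact zero_ne_one hf_int
  have hfni : Integrable (fun x => f (-x)) := hfi.comp_neg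
  have qmp : Measure.QuasiMeasurePreserving (fun x : ℝ => -x) volume volume :=
    (Measure.measurePreserving_neg (volume : Measure ℝ)).quasiMeasurePreserving
  have hfn : ∀ᵐ x ∂(volume : Measure ℝ), 0 ≤ f (-x) := qmp.ae hf_nonneg
  have hmi : Integrable (fun x => min (f x) (f (-x))) := hfi.inf hfni
  have hmm : Measurable (fun x => min (f x) (f (-x))) :=
    hf_meas.min (hf_meas.comp measurable_neg)
  have hm0 : ∀ᵐ x ∂(volume : Measure ℝ), 0 ≤ min (f x) (f (-x)) := by
    filter_upwards [hf_nonneg, hfn] with x h1 h2 using le_min h1 h2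
  have hI0 : 0 ≤ ∫ x, min (f x) (f (-x)) := integral_nonneg_of_ae hm0
  have hI1 : ∫ x, min (f x) (f (-x)) ≤ 1 := by
    rw [← hf_int]
    exact integral_mono hmi hfi (fun x => min_le_left _ _)
  apply IsGreatest.csSup_eq
  constructor
  · refine ⟨⟨hI0, hI1⟩, ?_⟩
    rcases hI0.eq_or_lt with h0 | hpos
    · refine ⟨fun x => (f x + f (-x)) / 2,
        (hf_meas.add (hf_meas.comp measurable_neg)).div_const 2, ?_, ?_, ?_, ?_⟩
      · filter_upwards [hf_nonneg, hfn] with x h1 h2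
        positivity
      · rw [integral_div, integral_add hfi hfni, integral_neg_eq_self f volume, hf_int]
        norm_num
      · refine Filter.Eventually.of_forall fun x => ?_
        simp only [neg_neg, add_comm]
      · rw [← h0]
        filter_upwards [hf_nonneg] with x h1
        simpa using h1
    · set I := ∫ x, min (f x) (f (-x)) with hI
      refine ⟨fun x => min (f x) (f (-x)) / I, hmm.div_const I, ?_, ?_, ?_, ?_⟩
      · filter_upwards [hm0] with x h1
        exact div_nonneg h1 hI0
      · rw [integral_div, ← hI, div_self hpos.ne']
      · refine Filter.Eventually.of_forall fun x => ?_
        simp only [neg_neg, min_comm]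
      · refine Filter.Eventually.of_forall fun x => ?_
        simp only
        rw [mul_div_cancel₀ _ hpos.ne']
        exact sub_nonneg.2 (min_le_left _ _)
  · rintro π ⟨_, g, _, _, hg1, hgs, hgf⟩
    have hgi : Integrable g := by
      by_contra h
      rw [integral_undef h] at hg1
      exact zero_ne_one hg1
    have hgfn : ∀ᵐ x ∂(volume : Measure ℝ), 0 ≤ f (-x) - π * g (-x) := qmp.ae hgf
    calc π = ∫ x, π * g x := by rw [integral_const_mul, hg1, mul_one]
      _ ≤ _ := by
        apply integral_mono_ae (hgi.const_mul π) hmi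
        filter_upwards [hgs, hgf, hgfn] with x h1 h2 h3
        rw [← h1] at h3
        exact le_min (by linarith) (by linarith)
end

section
/- Let f be a probability density on ℝ, h₀(x) := min{f(x), f(−x)}, and π₀ := ∫_ℝ h₀. If π₀ > 0, then g₀ := h₀/π₀ is an even probability density satisfying f − π₀ g₀ ≥ 0 almost everywhere, and any even probability density g with f − π₀ g ≥ 0 almost everywhere satisfies g = g₀ almost everywhere. -/
open MeasureTheory

/-- If `π₀ = ∫ min (f x) (f (-x)) dx > 0`, then
`g₀ = (min (f x) (f (-x))) / π₀` is an even probability density with `f - π₀ g₀ ≥ 0` a.e.,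
and it is the unique such even density (up to a.e. equality). -/
theorem symmetric_background_density_unique
    (f : ℝ → ℝ) (hf_meas : Measurable f)
    (hf_nonneg : ∀ᵐ x ∂(volume : Measure ℝ), 0 ≤ f x)
    (hf_int : ∫ x, f x = 1)
    (π₀ : ℝ) (hπ₀ : π₀ = ∫ x, min (f x) (f (-x)))
    (hpos : 0 < π₀) :
    ((∀ᵐ x ∂(volume : Measure ℝ), 0 ≤ min (f x) (f (-x)) / π₀) ∧
      (∫ x, min (f x) (f (-x)) / π₀ = 1) ∧
      (∀ᵐ x ∂(volume : Measure ℝ),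
        min (f x) (f (-x)) / π₀ = min (f (-x)) (f (-(-x))) / π₀) ∧
      (∀ᵐ x ∂(volume : Measure ℝ), 0 ≤ f x - π₀ * (min (f x) (f (-x)) / π₀))) ∧
    ∀ g : ℝ → ℝ, Measurable g → (∀ᵐ x ∂(volume : Measure ℝ), 0 ≤ g x) →
      (∫ x, g x = 1) → (∀ᵐ x ∂(volume : Measure ℝ), g x = g (-x)) →
      (∀ᵐ x ∂(volume : Measure ℝ), 0 ≤ f x - π₀ * g x) →
      g =ᵐ[(volume : Measure ℝ)] fun x => min (f x) (f (-x)) / π₀ := by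
  have hneg : Filter.Tendsto (fun x : ℝ => -x) (ae volume) (ae volume) :=
    (Measure.measurePreserving_neg (volume : Measure ℝ)).quasiMeasurePreserving.tendsto_ae
  have hf_nonneg' : ∀ᵐ x ∂(volume : Measure ℝ), 0 ≤ f (-x) := hneg.eventually hf_nonneg
  have hI : Integrable (fun x => min (f x) (f (-x))) := by
    by_contra h
    rw [integral_undef h] at hπ₀
    exact hpos.ne' hπ₀
  have h1 : ∫ x, min (f x) (f (-x)) / π₀ = 1 := by
    rw [integral_div, ← hπ₀, div_self hpos.ne']
  refine ⟨⟨?_, h1, ?_, ?_⟩, ?_⟩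
  · filter_upwards [hf_nonneg, hf_nonneg'] with x hx hx'
    exact div_nonneg (le_min hx hx') hpos.le
  · refine Filter.Eventually.of_forall fun x => ?_
    simp only [neg_neg]
    rw [min_comm]
  · refine Filter.Eventually.of_forall fun x => ?_
    rw [mul_div_cancel₀ _ hpos.ne']
    exact sub_nonneg.2 (min_le_left _ _)
  · intro g _ _ hg1 hge hgf
    have hgf' : ∀ᵐ x ∂(volume : Measure ℝ), 0 ≤ f (-x) - π₀ * g (-x) := hneg.eventually hgf
    have hgI : Integrable g := by
      by_contra h
      rw [integral_undef h] at hg1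
      exact zero_ne_one hg1
    have hle : g ≤ᵐ[volume] fun x => min (f x) (f (-x)) / π₀ := by
      filter_upwards [hge, hgf, hgf'] with x h2 h3 h4
      rw [← h2] at h4
      rw [le_div_iff₀ hpos, mul_comm]
      exact le_min (by linarith) (by linarith)
    exact (integral_eq_iff_of_ae_le hgI (hI.div_const π₀) hle).1 (by rw [hg1, h1])
end

section
/- Let f be a probability density supported on [0, ∞) that is càdlàg on [0, ∞), and define π₀ := ∫_0^∞ ess inf{f(y) : 0 ≤ y ≤ x} dx. Then π₀ = 0 if and only if f(0) = 0. -/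
open MeasureTheory

/-- The essential infimum of `f` over `[0, x]`: the supremum of those `t` such that
`{y ∈ [0, x] : f y < t}` has Lebesgue measure zero. -/
noncomputable def essInfIcc (f : ℝ → ℝ) (x : ℝ) : ℝ :=
  sSup {t : ℝ | volume {y : ℝ | y ∈ Set.Icc 0 x ∧ f y < t} = 0}

/-- `f` is càdlàg on `[0, ∞)`: right-continuous everywhere on `[0, ∞)` and admitting left
limits at every point of `(0, ∞)`. -/
def CadlagOnIci (f : ℝ → ℝ) : Prop :=
  (∀ x : ℝ, 0 ≤ x → ContinuousWithinAt f (Set.Ici x) x) ∧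
    (∀ x : ℝ, 0 < x → ∃ l : ℝ, Filter.Tendsto f (nhdsWithin x (Set.Iio x)) (nhds l))

/-- Any admissible level on `[0, x]` is a lower bound of `f` on `[0, x)`. -/
theorem level_le (f : ℝ → ℝ) (hc : CadlagOnIci f) {x y t : ℝ} (hy : 0 ≤ y) (hyx : y < x)
    (ht : volume {y : ℝ | y ∈ Set.Icc 0 x ∧ f y < t} = 0) : t ≤ f y := by
  by_contra hlt
  push Not at hlt
  have h1 : ∀ᶠ z in nhdsWithin y (Set.Ici y), f z < t := (hc.1 y hy).eventually_lt_const hlt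
  obtain ⟨u, hu, hsub⟩ := (mem_nhdsGE_iff_exists_Ico_subset' hyx).1 h1
  have hu' : y < u := hu
  have h2 : Set.Ico y (min u x) ⊆ {y : ℝ | y ∈ Set.Icc 0 x ∧ f y < t} := by
    intro z hz
    have hz2 := lt_min_iff.1 hz.2
    exact ⟨⟨hy.trans hz.1, hz2.2.le⟩, hsub ⟨hz.1, hz2.1⟩⟩
  have h3 := measure_mono_null h2 ht
  rw [Real.volume_Ico, ENNReal.ofReal_eq_zero] at h3
  have := lt_min hu' hyx
  linarith

theorem zero_level (f : ℝ → ℝ)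
    (hf : ∀ᵐ x ∂((volume : Measure ℝ).restrict (Set.Ici 0)), 0 ≤ f x) (x : ℝ) :
    volume {y : ℝ | y ∈ Set.Icc 0 x ∧ f y < 0} = 0 := by
  rw [ae_restrict_iff' measurableSet_Ici] at hf
  refine measure_mono_null ?_ (ae_iff.1 hf)
  intro y hy
  simp only [Set.mem_setOf_eq, Set.mem_Ici, not_forall, not_le]
  exact ⟨hy.1.1, hy.2⟩

theorem level_bdd (f : ℝ → ℝ) (hc : CadlagOnIci f) {x : ℝ} (hx : 0 < x) :
    BddAbove {t : ℝ | volume {y : ℝ | y ∈ Set.Icc 0 x ∧ f y < t} = 0} :=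
  ⟨f 0, fun _ ht => level_le f hc le_rfl hx ht⟩

/-- For a càdlàg density `f` on `[0, ∞)`, the monotone background
proportion `π₀ = ∫_0^∞ essinf_{[0,x]} f dx` vanishes if and only if `f 0 = 0`. -/
theorem monotone_background_zero_iff
    (f : ℝ → ℝ) (hf_meas : Measurable f)
    (hf_nonneg : ∀ᵐ x ∂((volume : Measure ℝ).restrict (Set.Ici 0)), 0 ≤ f x)
    (hf_int : ∫ x in Set.Ici (0 : ℝ), f x = 1)
    (hf_cadlag : CadlagOnIci f) :
    (∫ x in Set.Ici (0 : ℝ), essInfIcc f x) = 0 ↔ f 0 = 0 := by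
  have hg0 : ∀ x, 0 < x → 0 ≤ essInfIcc f x := fun x hx =>
    le_csSup (level_bdd f hf_cadlag hx) (zero_level f hf_nonneg x)
  have hgf : ∀ x y, 0 ≤ y → y < x → essInfIcc f x ≤ f y := fun x y hy hyx =>
    csSup_le ⟨0, zero_level f hf_nonneg x⟩ fun t ht => level_le f hf_cadlag hy hyx ht
  have hanti : AntitoneOn (essInfIcc f) (Set.Ioi 0) := by
    intro a ha b hb hab
    refine csSup_le_csSup (level_bdd f hf_cadlag ha) ⟨0, zero_level f hf_nonneg b⟩ ?_
    intro t ht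
    refine measure_mono_null ?_ ht
    intro y hy
    exact ⟨⟨hy.1.1, hy.1.2.trans hab⟩, hy.2⟩
  rw [integral_Ici_eq_integral_Ioi]
  have hfint : IntegrableOn f (Set.Ioi 0) := by
    rw [← integrableOn_Ici_iff_integrableOn_Ioi]
    by_contra h
    rw [integral_undef h] at hf_int
    exact zero_ne_one hf_int
  have hanti2 : AntitoneOn (fun x => essInfIcc f (2 * x)) (Set.Ioi 0) := by
    intro a ha b hb hab
    have ha' : (0:ℝ) < a := ha
    have hb' : (0:ℝ) < b := hb
    exact hanti (show (0:ℝ) < 2 * a by linarith) (show (0:ℝ) < 2 * b by linarith) (by linarith)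
  have hg2 : IntegrableOn (fun x => essInfIcc f (2 * x)) (Set.Ioi 0) := by
    refine Integrable.mono' hfint
      (aemeasurable_restrict_of_antitoneOn measurableSet_Ioi hanti2).aestronglyMeasurable ?_
    refine (ae_restrict_iff' measurableSet_Ioi).2 (Filter.Eventually.of_forall fun x hx => ?_)
    have hx' : (0:ℝ) < x := hx
    rw [Real.norm_of_nonneg (hg0 _ (by linarith))]
    exact hgf _ _ hx'.le (by linarith)
  have hgint : IntegrableOn (essInfIcc f) (Set.Ioi 0) := by
    have := (integrableOn_Ioi_comp_mul_left_iff (essInfIcc f) 0 (a := 2) (by norm_num)).1 hg2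
    simpa using this
  constructor
  · intro h
    have hnn : 0 ≤ᵐ[volume.restrict (Set.Ioi (0:ℝ))] essInfIcc f :=
      (ae_restrict_iff' measurableSet_Ioi).2 (Filter.Eventually.of_forall fun x hx => hg0 x hx)
    have hz := (setIntegral_eq_zero_iff_of_nonneg_ae hnn hgint).1 h
    by_contra hne
    have hpos : 0 < f 0 := lt_of_le_of_ne
      ((hg0 1 one_pos).trans (hgf 1 0 le_rfl one_pos)) (Ne.symm hne)
    have h1 : ∀ᶠ z in nhdsWithin 0 (Set.Ici 0), f 0 / 2 < f z :=
      (hf_cadlag.1 0 le_rfl).eventually_const_lt (by linarith)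
    obtain ⟨u, hu, hsub⟩ := (mem_nhdsGE_iff_exists_Ico_subset' (zero_lt_one' ℝ)).1 h1
    have hu' : (0:ℝ) < u := hu
    have hlow : ∀ x ∈ Set.Ioo 0 u, f 0 / 2 ≤ essInfIcc f x := by
      intro x hx
      refine le_csSup (level_bdd f hf_cadlag hx.1) ?_
      refine measure_mono_null ?_ (measure_empty (μ := volume))
      intro y hy
      have : f 0 / 2 < f y := hsub ⟨hy.1.1, hy.1.2.trans_lt hx.2⟩
      exact absurd hy.2 this.not_gt
    have hz' := ae_iff.1 ((ae_restrict_iff' measurableSet_Ioi).1 hz)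
    have h3 : volume (Set.Ioo 0 u) = 0 := by
      refine measure_mono_null ?_ hz'
      intro x hx hh
      have h4 := hlow x hx
      have h5 : essInfIcc f x = 0 := hh hx.1
      linarith
    rw [Real.volume_Ioo, ENNReal.ofReal_eq_zero] at h3
    linarith
  · intro h
    refine setIntegral_eq_zero_of_forall_eq_zero fun x hx => ?_
    exact le_antisymm (h ▸ hgf x 0 le_rfl hx) (hg0 x hx)
end

section
/- Let f be a probability density on ℝ. Then the optimization problem: maximize ∫_ℝ h over all log-concave functions h : ℝ → [0, ∞) with h(x) ≤ f(x) for almost every x, admits a maximizer; that is, there exists a log-concave h* : ℝ → [0, ∞) with h* ≤ f almost everywhere such that ∫_ℝ h* = sup{∫_ℝ h : h log-concave, 0 ≤ h ≤ f a.e.}. -/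
open MeasureTheory

/-- A function `h : ℝ → [0, ∞)` is log-concave: it is nonnegative and satisfies
`h (l*x + (1-l)*y) ≥ h x ^ l * h y ^ (1-l)` for all `x, y` and `l ∈ [0, 1]`
(real exponentiation). -/
def LogConcaveFn (h : ℝ → ℝ) : Prop :=
  (∀ x : ℝ, 0 ≤ h x) ∧
    ∀ x y l : ℝ, l ∈ Set.Icc (0 : ℝ) 1 →
      h x ^ l * h y ^ (1 - l) ≤ h (l * x + (1 - l) * y)

open Filter Topology

lemma LogConcaveFn.ordConnected {h : ℝ → ℝ} (hh : LogConcaveFn h) (t : ℝ) :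
    {x | t < h x}.OrdConnected := by
  refine ⟨fun x hx y hy z hz => ?_⟩
  simp only [Set.mem_ofPred_eq] at *
  rcases lt_or_ge t 0 with ht | ht
  · exact ht.trans_le (hh.1 z)
  have hz' : z ∈ segment ℝ x y := by
    rw [segment_eq_Icc (hz.1.trans hz.2)]; exact hz
  obtain ⟨a, b, ha, hb, hab, rfl⟩ := hz'
  have hb' : b = 1 - a := by linarith
  subst hb'
  have key := hh.2 x y a ⟨ha, by linarith⟩
  set m := min (h x) (h y) with hm
  have htm : t < m := lt_min hx hy
  have hm0 : 0 < m := ht.trans_lt htm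
  calc t < m := htm
    _ = m ^ a * m ^ (1 - a) := by rw [← Real.rpow_add hm0]; simp
    _ ≤ h x ^ a * h y ^ (1 - a) := by
        exact mul_le_mul (Real.rpow_le_rpow hm0.le (min_le_left _ _) ha)
          (Real.rpow_le_rpow hm0.le (min_le_right _ _) hb)
          (Real.rpow_nonneg hm0.le _) (Real.rpow_nonneg (hh.1 x) _)
    _ ≤ _ := by simpa using key

lemma LogConcaveFn.measurable {h : ℝ → ℝ} (hh : LogConcaveFn h) : Measurable h :=
  measurable_of_Ioi fun t => (hh.ordConnected t).measurableSet

/-- lower endpoint of a set of reals -/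
noncomputable def lowEnd (s : Set ℝ) : EReal := sInf ((fun x : ℝ => (x : EReal)) '' s)
/-- upper endpoint of a set of reals -/
noncomputable def uppEnd (s : Set ℝ) : EReal := sSup ((fun x : ℝ => (x : EReal)) '' s)

lemma mem_of_ends {s : Set ℝ} (hs : s.OrdConnected) {x : ℝ} (h1 : lowEnd s < x)
    (h2 : (x : EReal) < uppEnd s) : x ∈ s := by
  obtain ⟨_, ⟨a, ha, rfl⟩, hax⟩ := sInf_lt_iff.1 h1
  obtain ⟨_, ⟨b, hb, rfl⟩, hbx⟩ := lt_sSup_iff.1 h2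
  exact hs.out ha hb ⟨(EReal.coe_lt_coe_iff.1 hax).le, (EReal.coe_lt_coe_iff.1 hbx).le⟩

lemma not_mem_of_lt_lowEnd {s : Set ℝ} {x : ℝ} (h1 : (x : EReal) < lowEnd s) : x ∉ s :=
  fun hx => absurd h1 (not_lt.2 (sInf_le ⟨x, hx, rfl⟩))

lemma not_mem_of_uppEnd_lt {s : Set ℝ} {x : ℝ} (h1 : uppEnd s < (x : EReal)) : x ∉ s :=
  fun hx => absurd h1 (not_lt.2 (le_sSup ⟨x, hx, rfl⟩))

/-- Helly-type selection. -/
lemma exists_subseq (h : ℕ → ℝ → ℝ) (hh : ∀ n, LogConcaveFn (h n)) :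
    ∃ φ : ℕ → ℕ, StrictMono φ ∧ ∀ᵐ x ∂(volume : Measure ℝ), ∀ t : ℚ,
      (∀ᶠ n in atTop, (t : ℝ) < h (φ n) x) ∨ (∀ᶠ n in atTop, ¬ (t : ℝ) < h (φ n) x) := by
  let F : ℕ → ℚ → EReal × EReal := fun n t =>
    (lowEnd {x | (t : ℝ) < h n x}, uppEnd {x | (t : ℝ) < h n x})
  obtain ⟨L, φ, hφ, hL⟩ := SeqCompactSpace.tendsto_subseq F
  refine ⟨φ, hφ, ?_⟩
  have hc : {x : ℝ | ∃ t : ℚ, (x : EReal) = (L t).1 ∨ (x : EReal) = (L t).2}.Countable := by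
    have : {x : ℝ | ∃ t : ℚ, (x : EReal) = (L t).1 ∨ (x : EReal) = (L t).2}
        = (fun x : ℝ => (x : EReal)) ⁻¹'
          (Set.range (fun t => (L t).1) ∪ Set.range (fun t => (L t).2)) := by
      ext x
      simp only [Set.mem_ofPred_eq, Set.mem_preimage, Set.mem_union, Set.mem_range, exists_or,
        eq_comm]
    rw [this]
    exact Set.Countable.preimage_of_injOn
      ((Set.countable_range _).union (Set.countable_range _)) (EReal.coe_injective.injOn)
  filter_upwards [hc.ae_notMem volume] with x hx t
  simp only [Set.mem_ofPred_eq, not_exists, not_or] at hx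
  obtain ⟨hx1, hx2⟩ := hx t
  have hLt := (tendsto_pi_nhds.1 hL) t
  have h1 : Tendsto (fun n => lowEnd {x | (t : ℝ) < h (φ n) x}) atTop (𝓝 (L t).1) :=
    (continuous_fst.tendsto _).comp hLt
  have h2 : Tendsto (fun n => uppEnd {x | (t : ℝ) < h (φ n) x}) atTop (𝓝 (L t).2) :=
    (continuous_snd.tendsto _).comp hLt
  rcases lt_or_gt_of_ne hx1 with hlt | hgt
  · right
    filter_upwards [h1.eventually_const_lt hlt] with n hn
    exact not_mem_of_lt_lowEnd (s := {x | (t : ℝ) < h (φ n) x}) hn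
  · rcases lt_or_gt_of_ne hx2 with hlt2 | hgt2
    · left
      filter_upwards [h1.eventually_lt_const hgt, h2.eventually_const_lt hlt2] with n hn hn2
      exact mem_of_ends ((hh _).ordConnected _) hn hn2
    · right
      filter_upwards [h2.eventually_lt_const hgt2] with n hn
      exact not_mem_of_uppEnd_lt (s := {x | (t : ℝ) < h (φ n) x}) hn

/-- pointwise liminf in `ℝ≥0∞`. -/
noncomputable def limG (h : ℕ → ℝ → ℝ) (x : ℝ) : ENNReal :=
  liminf (fun n => ENNReal.ofReal (h n x)) atTop

lemma liminf_rpow (u : ℕ → ENNReal) {l : ℝ} (hl : 0 < l) :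
    liminf (fun n => u n ^ l) atTop = (liminf u atTop) ^ l := by
  have := (ENNReal.orderIsoRpow l hl).liminf_apply (f := atTop) (u := u)
  simpa using this.symm

lemma limG_logconcave (h : ℕ → ℝ → ℝ) (hh : ∀ n, LogConcaveFn (h n)) (x y l : ℝ)
    (h0 : 0 < l) (h1 : l < 1) :
    limG h x ^ l * limG h y ^ (1 - l) ≤ limG h (l * x + (1 - l) * y) := by
  have h1' : 0 < 1 - l := by linarith
  unfold limG
  rw [← liminf_rpow _ h0, ← liminf_rpow _ h1']
  refine ENNReal.le_liminf_mul.trans ?_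
  refine liminf_le_liminf (Eventually.of_forall fun n => ?_)
  simp only [Pi.mul_apply]
  rw [ENNReal.ofReal_rpow_of_nonneg ((hh n).1 x) h0.le,
    ENNReal.ofReal_rpow_of_nonneg ((hh n).1 y) h1'.le,
    ← ENNReal.ofReal_mul (Real.rpow_nonneg ((hh n).1 x) _)]
  exact ENNReal.ofReal_le_ofReal ((hh n).2 x y l ⟨h0.le, h1.le⟩)

lemma limG_toReal_logconcave (h : ℕ → ℝ → ℝ) (hh : ∀ n, LogConcaveFn (h n))
    (hfin : ∀ᵐ x ∂(volume : Measure ℝ), limG h x ≠ ⊤) :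
    LogConcaveFn (fun x => (limG h x).toReal) := by
  refine ⟨fun x => ENNReal.toReal_nonneg, fun x y l hl => ?_⟩
  rcases hl.1.eq_or_lt with rfl | h0
  · simp
  rcases hl.2.eq_or_lt with rfl | h1
  · simp
  have h1' : 0 < 1 - l := by linarith
  by_cases hex : ∃ x0, limG h x0 = ⊤
  · obtain ⟨x0, hx0⟩ := hex
    have hz : ∀ y, limG h y = ⊤ ∨ limG h y = 0 := by
      intro y
      by_contra! hy
      have hne : x0 ≠ y := fun e => hy.1 (e ▸ hx0)
      have hsub : openSegment ℝ x0 y ⊆ {x | limG h x = ⊤} := by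
        rintro _ ⟨a, b, ha, hb, hab, rfl⟩
        have hb' : b = 1 - a := by linarith
        subst hb'
        have key := limG_logconcave h hh x0 y a ha (by linarith)
        rw [hx0, ENNReal.top_rpow_of_pos ha, ENNReal.top_mul] at key
        · simpa using key
        · simp [ENNReal.rpow_eq_zero_iff, hy.1, hy.2]
      have hnull : volume (openSegment ℝ x0 y) = 0 := by
        refine measure_mono_null hsub ?_
        simpa [ae_iff] using hfin
      rw [openSegment_eq_Ioo' hne, Real.volume_Ioo] at hnull
      simp at hnull
      exact hne (le_antisymm hnull.2 hnull.1)
    have hz' : ∀ y, (limG h y).toReal = 0 := fun y => by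
      rcases hz y with e | e <;> simp [e]
    simp only [hz']
    rw [Real.zero_rpow h0.ne']; simp
  · push Not at hex
    have key := ENNReal.toReal_mono (hex _) (limG_logconcave h hh x y l h0 h1)
    simpa [ENNReal.toReal_mul, ENNReal.toReal_rpow] using key

theorem logconcave_background_exists_maximizer
    (f : ℝ → ℝ) (hf_meas : Measurable f)
    (hf_nonneg : ∀ᵐ x ∂(volume : Measure ℝ), 0 ≤ f x)
    (hf_int : ∫ x, f x = 1) :
    ∃ hstar : ℝ → ℝ, LogConcaveFn hstar ∧ (∀ᵐ x ∂(volume : Measure ℝ), hstar x ≤ f x) ∧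
      (∫ x, hstar x) =
        sSup {r : ℝ | ∃ h : ℝ → ℝ, LogConcaveFn h ∧
          (∀ᵐ x ∂(volume : Measure ℝ), h x ≤ f x) ∧ r = ∫ x, h x} := by
  have hfi : Integrable f := by
    by_contra hc
    rw [integral_undef hc] at hf_int
    exact zero_ne_one hf_int
  set S := {r : ℝ | ∃ h : ℝ → ℝ, LogConcaveFn h ∧
          (∀ᵐ x ∂(volume : Measure ℝ), h x ≤ f x) ∧ r = ∫ x, h x} with hS
  have hdom : ∀ h, LogConcaveFn h → (∀ᵐ x ∂(volume : Measure ℝ), h x ≤ f x) →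
      ∀ᵐ x ∂(volume : Measure ℝ), ‖h x‖ ≤ f x := by
    intro h hl hle
    filter_upwards [hle] with x hx
    rwa [Real.norm_of_nonneg (hl.1 x)]
  have hbdd : BddAbove S := by
    refine ⟨1, ?_⟩
    rintro r ⟨h, hl, hle, rfl⟩
    rw [← hf_int]
    exact integral_mono_ae (hfi.mono' hl.measurable.aestronglyMeasurable (hdom h hl hle)) hfi hle
  have hne : S.Nonempty := by
    refine ⟨_, fun _ => 0, ⟨fun _ => le_rfl, fun x y l hl => ?_⟩, hf_nonneg, rfl⟩
    rcases hl.1.eq_or_lt with rfl | h0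
    · simp
    · simp [Real.zero_rpow h0.ne']
  obtain ⟨u, -, hu, huS⟩ := exists_seq_tendsto_sSup hne hbdd
  choose h hl hle hint using huS
  obtain ⟨φ, hφ, hconv⟩ := exists_subseq h hl
  have hle' : ∀ᵐ x ∂(volume : Measure ℝ), ∀ n, h n x ≤ f x := ae_all_iff.2 hle
  have hlim : ∀ᵐ x ∂(volume : Measure ℝ), limG (fun n => h (φ n)) x ≠ ⊤ ∧
      (limG (fun n => h (φ n)) x).toReal ≤ f x ∧
      Tendsto (fun n => h (φ n) x) atTop (𝓝 (limG (fun n => h (φ n)) x).toReal) := by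
    filter_upwards [hle', hconv, hf_nonneg] with x hx hc hf0
    have hcv : ∃ c, Tendsto (fun n => h (φ n) x) atTop (𝓝 c) := by
      refine tendsto_of_no_upcrossings (s := Set.range ((↑) : ℚ → ℝ)) Rat.denseRange_cast ?_
        (isBoundedUnder_of ⟨f x, fun n => hx _⟩) (isBoundedUnder_of ⟨0, fun n => (hl _).1 x⟩)
      rintro _ ⟨a, rfl⟩ _ ⟨b, rfl⟩ hab ⟨ha, hb⟩
      rcases hc a with e | e
      · exact ha (e.mono fun n hn => not_lt.2 hn.le)
      · exact hb (e.mono fun n hn => not_lt.2 ((not_lt.1 hn).trans hab.le))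
    obtain ⟨c, hc'⟩ := hcv
    have hc0 : 0 ≤ c := ge_of_tendsto' hc' fun n => (hl _).1 x
    have hcf : c ≤ f x := le_of_tendsto' hc' fun n => hx _
    have hG : limG (fun n => h (φ n)) x = ENNReal.ofReal c :=
      ((ENNReal.continuous_ofReal.tendsto c).comp hc').liminf_eq
    rw [hG, ENNReal.toReal_ofReal hc0]
    exact ⟨ENNReal.ofReal_ne_top, hcf, hc'⟩
  refine ⟨fun x => (limG (fun n => h (φ n)) x).toReal,
    limG_toReal_logconcave _ (fun n => hl _) (hlim.mono fun x hx => hx.1),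
    hlim.mono fun x hx => hx.2.1, ?_⟩
  have hI : Tendsto (fun n => ∫ x, h (φ n) x) atTop
      (𝓝 (∫ x, (limG (fun n => h (φ n)) x).toReal)) :=
    tendsto_integral_of_dominated_convergence f
      (fun n => (hl _).measurable.aestronglyMeasurable) hfi
      (fun n => hdom _ (hl _) (hle _)) (hlim.mono fun x hx => hx.2.2)
  have hI2 : Tendsto (fun n => ∫ x, h (φ n) x) atTop (𝓝 (sSup S)) := by
    have := hu.comp hφ.tendsto_atTop
    simpa only [Function.comp_def, hint] using this
  exact tendsto_nhds_unique hI hI2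
end

section
/- Let f and f̂ be probability densities on ℝ, and for a density g set π₀(g) := sup{∫_ℝ h : h log-concave, 0 ≤ h ≤ g a.e.}. Let η ∈ [0, 1) and a > 0, and suppose f(x) ≤ (1 + η) f̂(x) for almost every x ∈ [−a, a], with (1 − η)(1 + η) ≤ 1. Then π₀(f̂) ≥ (1 − η) · (π₀(f) − ∫_{|x| > a} f(x) dx). -/
open MeasureTheory

/-- The log-concave background proportion of a function `g`: the supremum of `∫ h` over
log-concave `h` with `h ≤ g` a.e. -/
noncomputable def logConcaveProp (g : ℝ → ℝ) : ℝ :=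
  sSup {r : ℝ | ∃ h : ℝ → ℝ, LogConcaveFn h ∧
    (∀ᵐ x ∂(volume : Measure ℝ), h x ≤ g x) ∧ r = ∫ x, h x}

lemma LogConcaveFn.trunc {h : ℝ → ℝ} (hh : LogConcaveFn h) {c : ℝ} (hc : 0 ≤ c) (a : ℝ) :
    LogConcaveFn (fun x => c * (Set.Icc (-a) a).indicator h x) := by
  have hn : ∀ x, 0 ≤ c * (Set.Icc (-a) a).indicator h x := fun x =>
    mul_nonneg hc (Set.indicator_nonneg (fun x _ => hh.1 x) x)
  refine ⟨hn, ?_⟩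
  intro x y l hl
  rcases hl.1.eq_or_lt with h0 | h0
  · subst h0; simp
  rcases hl.2.eq_or_lt with h1 | h1
  · subst h1; simp
  have h1' : 0 < 1 - l := by linarith
  by_cases hx : x ∈ Set.Icc (-a) a
  · by_cases hy : y ∈ Set.Icc (-a) a
    · have hz : l * x + (1 - l) * y ∈ Set.Icc (-a) a := by
        have := (convex_Icc (-a) a) hx hy hl.1 h1'.le (by ring)
        simpa using this
      simp only [Set.indicator_of_mem hx, Set.indicator_of_mem hy, Set.indicator_of_mem hz]
      rw [Real.mul_rpow hc (hh.1 x), Real.mul_rpow hc (hh.1 y)]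
      have hcc : c ^ l * c ^ (1 - l) = c := by
        rw [← Real.rpow_add' hc (by norm_num)]; simp
      calc c ^ l * h x ^ l * (c ^ (1 - l) * h y ^ (1 - l))
          = (c ^ l * c ^ (1 - l)) * (h x ^ l * h y ^ (1 - l)) := by ring
        _ = c * (h x ^ l * h y ^ (1 - l)) := by rw [hcc]
        _ ≤ _ := mul_le_mul_of_nonneg_left (hh.2 x y l hl) hc
    · have : ((c * (Set.Icc (-a) a).indicator h y) : ℝ) = 0 := by
        rw [Set.indicator_of_notMem hy]; simp
      simp only [this]
      rw [Real.zero_rpow h1'.ne', mul_zero]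
      exact hn _
  · have : ((c * (Set.Icc (-a) a).indicator h x) : ℝ) = 0 := by
      rw [Set.indicator_of_notMem hx]; simp
    simp only [this]
    rw [Real.zero_rpow h0.ne', zero_mul]
    exact hn _

lemma logConcaveFn_zero : LogConcaveFn (fun _ => 0) := by
  simpa using (LogConcaveFn.trunc (h := fun _ => 1) ⟨by simp, by simp⟩ le_rfl 0)

/-- If `f ≤ (1+η) f̂` a.e. on `[-a, a]` with `η ∈ [0,1)` and
`(1-η)(1+η) ≤ 1`, then `π₀(f̂) ≥ (1-η) (π₀(f) - ∫_{|x|>a} f)`. -/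
theorem logConcaveProp_lower_bound
    (f fhat : ℝ → ℝ) (hf_meas : Measurable f) (hfhat_meas : Measurable fhat)
    (hf_nonneg : ∀ᵐ x ∂(volume : Measure ℝ), 0 ≤ f x)
    (hfhat_nonneg : ∀ᵐ x ∂(volume : Measure ℝ), 0 ≤ fhat x)
    (hf_int : ∫ x, f x = 1) (hfhat_int : ∫ x, fhat x = 1)
    (η : ℝ) (hη0 : 0 ≤ η) (hη1 : η < 1) (a : ℝ) (ha : 0 < a)
    (hratio : ∀ᵐ x ∂((volume : Measure ℝ).restrict (Set.Icc (-a) a)),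
      f x ≤ (1 + η) * fhat x)
    (hprod : (1 - η) * (1 + η) ≤ 1) :
    (1 - η) * (logConcaveProp f - ∫ x in {x : ℝ | a < |x|}, f x) ≤
      logConcaveProp fhat := by
  have hfi : Integrable f := by
    by_contra h; rw [integral_undef h] at hf_int; norm_num at hf_int
  have hgi : Integrable fhat := by
    by_contra h; rw [integral_undef h] at hfhat_int; norm_num at hfhat_int
  have hbdd : BddAbove {r : ℝ | ∃ h : ℝ → ℝ, LogConcaveFn h ∧
      (∀ᵐ x ∂(volume : Measure ℝ), h x ≤ fhat x) ∧ r = ∫ x, h x} := by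
    refine ⟨1, ?_⟩
    rintro r ⟨h, -, hle, rfl⟩
    by_cases hi : Integrable h
    · rw [← hfhat_int]; exact integral_mono_ae hi hgi hle
    · rw [integral_undef hi]; norm_num
  have h0 : 0 ≤ logConcaveProp fhat :=
    le_csSup hbdd ⟨fun _ => 0, logConcaveFn_zero, hfhat_nonneg, by simp⟩
  have hpos : 0 < 1 - η := by linarith
  have hset : {x : ℝ | a < |x|} = (Set.Icc (-a) a)ᶜ := by
    ext x; simp only [Set.mem_setOf_eq, Set.mem_compl_iff, Set.mem_Icc, ← abs_le, not_le]
  rw [hset]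
  have hT : 0 ≤ ∫ x in (Set.Icc (-a) a)ᶜ, f x :=
    integral_nonneg_of_ae (ae_restrict_of_ae hf_nonneg)
  rw [mul_comm, ← le_div_iff₀ hpos, sub_le_iff_le_add]
  refine csSup_le ⟨0, fun _ => 0, logConcaveFn_zero, hf_nonneg, by simp⟩ ?_
  rintro r ⟨h, hh, hle, rfl⟩
  by_cases hi : Integrable h
  swap
  · rw [integral_undef hi]; positivity
  rw [← sub_le_iff_le_add, le_div_iff₀ hpos]
  have hk : (1 - η) * ∫ x in Set.Icc (-a) a, h x ≤ logConcaveProp fhat := by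
    refine le_csSup hbdd ⟨_, hh.trunc hpos.le a, ?_, ?_⟩
    · rw [ae_restrict_iff' measurableSet_Icc] at hratio
      filter_upwards [hratio, hle, hfhat_nonneg] with x h1 h2 h3
      by_cases hx : x ∈ Set.Icc (-a) a
      · rw [Set.indicator_of_mem hx]
        calc (1 - η) * h x ≤ (1 - η) * ((1 + η) * fhat x) :=
              mul_le_mul_of_nonneg_left (h2.trans (h1 hx)) hpos.le
          _ = ((1 - η) * (1 + η)) * fhat x := by ring
          _ ≤ 1 * fhat x := mul_le_mul_of_nonneg_right hprod h3
          _ = fhat x := one_mul _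
      · rw [Set.indicator_of_notMem hx]; simpa using h3
    · rw [integral_const_mul, integral_indicator measurableSet_Icc]
  have hsplit := integral_add_compl (s := Set.Icc (-a) a) measurableSet_Icc hi
  have hc : ∫ x in (Set.Icc (-a) a)ᶜ, h x ≤ ∫ x in (Set.Icc (-a) a)ᶜ, f x :=
    integral_mono_ae hi.integrableOn hfi.integrableOn (ae_restrict_of_ae hle)
  refine le_trans ?_ hk
  rw [mul_comm]
  exact mul_le_mul_of_nonneg_left (by linarith) hpos.le
end

section
/- Let d ≥ 1 and let f be a continuous probability density on ℝ^d, and define π₀ := sup{π ∈ [0,1] : there exists a spherically symmetric probability density g on ℝ^d with f − π g ≥ 0 almost everywhere}. Define h₀(x) := min{f(y) : ‖y‖ = ‖x‖} (the minimum of f over the Euclidean sphere of radius ‖x‖, which is attained by continuity and compactness). Then π₀ = ∫_{ℝ^d} h₀(x) dx, and if π₀ > 0 then g₀ := h₀/π₀ is a spherically symmetric probability density attaining the supremum. -/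
open MeasureTheory

/-- The spherical minorant of `f`: `h₀ x` is the infimum (a minimum, by continuity and
compactness, when `f` is continuous and `d ≥ 1`) of `f` over the sphere of radius `‖x‖`. -/
noncomputable def sphericalMin {d : ℕ} (f : EuclideanSpace ℝ (Fin d) → ℝ)
    (x : EuclideanSpace ℝ (Fin d)) : ℝ :=
  sInf (f '' {y : EuclideanSpace ℝ (Fin d) | ‖y‖ = ‖x‖})

section helpers

variable {d : ℕ}

/-- Continuity and density argument: a lower bound of `f` along a dense family of
reflections of `x` holds on the whole sphere through `x`. -/
theorem le_on_sphere (f : EuclideanSpace ℝ (Fin d) → ℝ) (hf : Continuous f)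
    (x : EuclideanSpace ℝ (Fin d)) (c : ℝ) (h0 : c ≤ f x)
    (hn : ∀ n : ℕ, c ≤ f ((ℝ ∙ (TopologicalSpace.denseSeq
      (EuclideanSpace ℝ (Fin d)) n))ᗮ.reflection x))
    (y : EuclideanSpace ℝ (Fin d)) (hy : ‖y‖ = ‖x‖) : c ≤ f y := by
  by_cases hxy : x = y
  · rwa [← hxy]
  by_contra hlt
  push Not at hlt
  let F : EuclideanSpace ℝ (Fin d) → EuclideanSpace ℝ (Fin d) :=
    fun v => x - (2 * (inner ℝ v x / ‖v‖ ^ 2)) • v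
  have hF : ∀ v : EuclideanSpace ℝ (Fin d), (ℝ ∙ v)ᗮ.reflection x = F v := by
    intro v
    rw [Submodule.reflection_orthogonal_apply, Submodule.reflection_singleton_apply]
    simp only [F, two_smul, two_mul, add_smul]
    simp
  have hne : x - y ≠ 0 := sub_ne_zero.mpr hxy
  have hFy : F (x - y) = y := by
    rw [← hF]
    exact Submodule.reflection_sub hy.symm
  have hcF : ContinuousAt F (x - y) := by
    have : ‖x - y‖ ^ 2 ≠ 0 := by positivity
    fun_prop (disch := assumption)
  have hev : ∀ᶠ v in nhds (x - y), f (F v) < c := by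
    have : ContinuousAt (fun v => f (F v)) (x - y) := hf.continuousAt.comp hcF
    apply this.eventually_lt_const
    simpa only [hFy] using hlt
  obtain ⟨v, ⟨n, rfl⟩, hv⟩ := (TopologicalSpace.denseRange_denseSeq
    (EuclideanSpace ℝ (Fin d))).inter_nhds_nonempty hev
  have := hn n
  rw [hF] at this
  exact absurd hv (not_lt.mpr this)

theorem le_sphericalMin_of (f : EuclideanSpace ℝ (Fin d) → ℝ)
    (x : EuclideanSpace ℝ (Fin d)) (c : ℝ)
    (h : ∀ y : EuclideanSpace ℝ (Fin d), ‖y‖ = ‖x‖ → c ≤ f y) : c ≤ sphericalMin f x := by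
  apply le_csInf
  · exact ⟨f x, x, rfl, rfl⟩
  · rintro _ ⟨y, hy, rfl⟩
    exact h y hy

theorem sphericalMin_le_of (f : EuclideanSpace ℝ (Fin d) → ℝ) (h0 : ∀ x, 0 ≤ f x)
    (x y : EuclideanSpace ℝ (Fin d)) (hy : ‖y‖ = ‖x‖) : sphericalMin f x ≤ f y := by
  apply csInf_le
  · refine ⟨0, ?_⟩
    rintro _ ⟨y, hy, rfl⟩
    exact h0 y
  · exact ⟨y, hy, rfl⟩

theorem sphericalMin_radial (f : EuclideanSpace ℝ (Fin d) → ℝ)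
    (x y : EuclideanSpace ℝ (Fin d)) (hy : ‖x‖ = ‖y‖) :
    sphericalMin f x = sphericalMin f y := by
  simp only [sphericalMin, hy]

theorem measurable_sphericalMin (f : EuclideanSpace ℝ (Fin d) → ℝ) (hf : Continuous f)
    (h0 : ∀ x, 0 ≤ f x) : Measurable (sphericalMin f) := by
  apply measurable_of_Ici
  intro c
  have : sphericalMin f ⁻¹' Set.Ici c = {x | c ≤ f x} ∩ ⋂ n : ℕ,
      {x | c ≤ f ((ℝ ∙ (TopologicalSpace.denseSeq
        (EuclideanSpace ℝ (Fin d)) n))ᗮ.reflection x)} := by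
    ext x
    simp only [Set.mem_preimage, Set.mem_Ici, Set.mem_inter_iff, Set.mem_setOf_eq, Set.mem_iInter]
    constructor
    · intro h
      exact ⟨h.trans (sphericalMin_le_of f h0 x x rfl), fun n =>
        h.trans (sphericalMin_le_of f h0 x _ (LinearIsometryEquiv.norm_map _ _))⟩
    · rintro ⟨h1, h2⟩
      exact le_sphericalMin_of f x c (le_on_sphere f hf x c h1 h2)
  rw [this]
  refine MeasurableSet.inter (measurableSet_le measurable_const hf.measurable)
    (MeasurableSet.iInter fun n => measurableSet_le measurable_const ?_)
  exact (hf.comp (LinearIsometryEquiv.continuous _)).measurable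

theorem ae_le_sphericalMin (f g : EuclideanSpace ℝ (Fin d) → ℝ) (hf : Continuous f)
    (hg : ∀ x y : EuclideanSpace ℝ (Fin d), ‖x‖ = ‖y‖ → g x = g y)
    (h : ∀ᵐ x ∂(volume : Measure (EuclideanSpace ℝ (Fin d))), g x ≤ f x) :
    ∀ᵐ x ∂(volume : Measure (EuclideanSpace ℝ (Fin d))), g x ≤ sphericalMin f x := by
  have h2 : ∀ᵐ x ∂(volume : Measure (EuclideanSpace ℝ (Fin d))), ∀ n : ℕ,
      g x ≤ f ((ℝ ∙ (TopologicalSpace.denseSeq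
        (EuclideanSpace ℝ (Fin d)) n))ᗮ.reflection x) := by
    rw [ae_all_iff]
    intro n
    have := (LinearIsometryEquiv.measurePreserving ((ℝ ∙ (TopologicalSpace.denseSeq
        (EuclideanSpace ℝ (Fin d)) n))ᗮ.reflection)).quasiMeasurePreserving.ae h
    filter_upwards [this] with x hx
    rwa [hg _ x (LinearIsometryEquiv.norm_map _ _)] at hx
  filter_upwards [h, h2] with x h1 h2
  exact le_sphericalMin_of f x _ (le_on_sphere f hf x _ h1 h2)

end helpers

/-- For a continuous density `f` on `ℝᵈ` (`d ≥ 1`), the maximal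
proportion `π₀` of a spherically symmetric density fitting under `f` equals
`∫ h₀` where `h₀ x = min {f y : ‖y‖ = ‖x‖}`; and if `π₀ > 0`, then `g₀ = h₀ / π₀` is a
spherically symmetric probability density attaining the supremum. -/
theorem spherical_background_proportion
    (d : ℕ) (hd : 1 ≤ d)
    (f : EuclideanSpace ℝ (Fin d) → ℝ) (hf_cont : Continuous f)
    (hf_nonneg : ∀ᵐ x ∂(volume : Measure (EuclideanSpace ℝ (Fin d))), 0 ≤ f x)
    (hf_int : ∫ x, f x = 1)
    (π₀ : ℝ)
    (hπ₀ : π₀ = sSup {π : ℝ | π ∈ Set.Icc (0 : ℝ) 1 ∧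
      ∃ g : EuclideanSpace ℝ (Fin d) → ℝ, Measurable g ∧
        (∀ᵐ x ∂(volume : Measure (EuclideanSpace ℝ (Fin d))), 0 ≤ g x) ∧
        (∫ x, g x = 1) ∧
        (∀ x y : EuclideanSpace ℝ (Fin d), ‖x‖ = ‖y‖ → g x = g y) ∧
        (∀ᵐ x ∂(volume : Measure (EuclideanSpace ℝ (Fin d))), 0 ≤ f x - π * g x)}) :
    π₀ = (∫ x, sphericalMin f x) ∧
    (0 < π₀ →
      (∀ x y : EuclideanSpace ℝ (Fin d), ‖x‖ = ‖y‖ →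
        sphericalMin f x / π₀ = sphericalMin f y / π₀) ∧
      (∀ᵐ x ∂(volume : Measure (EuclideanSpace ℝ (Fin d))), 0 ≤ sphericalMin f x / π₀) ∧
      (∫ x, sphericalMin f x / π₀ = 1) ∧
      (∀ᵐ x ∂(volume : Measure (EuclideanSpace ℝ (Fin d))),
        0 ≤ f x - π₀ * (sphericalMin f x / π₀))) := by
  have hf0 : ∀ x, 0 ≤ f x := by
    intro x
    have hd' : Dense {x | 0 ≤ f x} := Measure.dense_of_ae hf_nonneg
    have hc : IsClosed {x | 0 ≤ f x} := isClosed_le continuous_const hf_cont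
    have : x ∈ closure {x | 0 ≤ f x} := hd' x
    rwa [hc.closure_eq] at this
  have hfi : Integrable f := by
    by_contra h
    rw [integral_undef h] at hf_int
    exact zero_ne_one hf_int
  have hm := measurable_sphericalMin f hf_cont hf0
  have hh0 : ∀ x, 0 ≤ sphericalMin f x := fun x =>
    le_sphericalMin_of f x 0 (fun y _ => hf0 y)
  have hhf : ∀ x, sphericalMin f x ≤ f x := fun x => sphericalMin_le_of f hf0 x x rfl
  have hhi : Integrable (sphericalMin f) := by
    refine hfi.mono' hm.aestronglyMeasurable (Filter.Eventually.of_forall fun x => ?_)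
    rw [Real.norm_of_nonneg (hh0 x)]
    exact hhf x
  have hP0 : 0 ≤ ∫ x, sphericalMin f x := integral_nonneg hh0
  have hP1 : ∫ x, sphericalMin f x ≤ 1 := by
    rw [← hf_int]
    exact integral_mono hhi hfi hhf
  have hint : ∀ p : ℝ, p = ∫ x, sphericalMin f x → 0 < p →
      ∫ x, sphericalMin f x / p = 1 := by
    intro p hp hpos
    rw [integral_div, ← hp, div_self hpos.ne']
  have hsub : ∀ p : ℝ, 0 < p → ∀ x, 0 ≤ f x - p * (sphericalMin f x / p) := by
    intro p hp x
    rw [mul_div_cancel₀ _ hp.ne']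
    exact sub_nonneg.mpr (hhf x)
  have key : π₀ = ∫ x, sphericalMin f x := by
    rw [hπ₀]
    have hub : ∀ p ∈ {π : ℝ | π ∈ Set.Icc (0 : ℝ) 1 ∧
      ∃ g : EuclideanSpace ℝ (Fin d) → ℝ, Measurable g ∧
        (∀ᵐ x ∂(volume : Measure (EuclideanSpace ℝ (Fin d))), 0 ≤ g x) ∧
        (∫ x, g x = 1) ∧
        (∀ x y : EuclideanSpace ℝ (Fin d), ‖x‖ = ‖y‖ → g x = g y) ∧
        (∀ᵐ x ∂(volume : Measure (EuclideanSpace ℝ (Fin d))), 0 ≤ f x - π * g x)},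
        p ≤ ∫ x, sphericalMin f x := by
      rintro p ⟨-, g, -, -, hg1, hgr, hgf⟩
      have hgi : Integrable g := by
        by_contra h
        rw [integral_undef h] at hg1
        exact zero_ne_one hg1
      have := ae_le_sphericalMin f (fun x => p * g x) hf_cont
        (fun x y hxy => by simp only [hgr x y hxy])
        (by filter_upwards [hgf] with x hx using sub_nonneg.mp hx)
      have h2 := integral_mono_ae (hgi.const_mul p) hhi this
      rwa [integral_const_mul, hg1, mul_one] at h2
    apply le_antisymm
    · exact Real.sSup_le hub hP0
    · rcases hP0.eq_or_lt with h | h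
      · rw [← h]
        exact Real.sSup_nonneg fun p hp => hp.1.1
      · refine le_csSup ⟨_, hub⟩ ⟨⟨hP0, hP1⟩, fun x => sphericalMin f x / ∫ x, sphericalMin f x,
          hm.div_const _, ?_, hint _ rfl h, ?_, ?_⟩
        · exact Filter.Eventually.of_forall fun x => div_nonneg (hh0 x) hP0
        · intro x y hxy
          simp only [sphericalMin_radial f x y hxy]
        · exact Filter.Eventually.of_forall (hsub _ h)
  refine ⟨key, fun hpos => ⟨fun x y hxy => ?_, ?_, hint _ key hpos, ?_⟩⟩
  · rw [sphericalMin_radial f x y hxy]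
  · exact Filter.Eventually.of_forall fun x => div_nonneg (hh0 x) hpos.le
  · exact Filter.Eventually.of_forall (hsub _ hpos)
end
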